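/- Let N ≥ 1, let A be a real N×N matrix with Aᵀ = −A, and let γ : Fin N → ℝ with γ_j > 0 for all j. Let D = diagonal(2γ) and let M be the complex 2N×2N block matrix M = [[A_ℂ, i·D_ℂ], [−i·D_ℂ, A_ℂ]] (Matrix.fromBlocks applied to the complexifications, indexed by Fin N ⊕ Fin N). Then, among the 2N roots of the characteristic polynomial of M counted with multiplicity, exactly N have strictly positive real part and exactly N have strictly negative real part, and the sum of the roots with positive real part equals 2·Σ_{j} γ_j. -/

import Mathlib

open Matrix

/-- An eigenvalue of the sum of a real antisymmetric matrix and a real diagonal matrix has as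
real part a weighted mean of the diagonal entries. -/
lemma exists_re_mul_sum_eq_of_mem_roots_charpoly {n : Type*} [Fintype n] [DecidableEq n]
    {A : Matrix n n ℝ} (hA : Aᵀ = -A) (d : n → ℝ) {μ : ℂ}
    (hμ : μ ∈ (A.map Complex.ofReal + (diagonal d).map Complex.ofReal).charpoly.roots) :
    ∃ w : n → ℝ, (∀ i, 0 ≤ w i) ∧ (∃ i, 0 < w i) ∧ μ.re * ∑ i, w i = ∑ i, d i * w i := by
  have hroot := Polynomial.isRoot_of_mem_roots hμ
  rw [Polynomial.IsRoot, eval_charpoly, ← exists_mulVec_eq_zero_iff] at hroot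
  obtain ⟨v, hv, hv0⟩ := hroot
  obtain ⟨j, hj⟩ := Function.ne_iff.mp hv
  refine ⟨fun i => Complex.normSq (v i), fun i => Complex.normSq_nonneg _,
    ⟨j, Complex.normSq_pos.mpr hj⟩, ?_⟩
  have hskew : (star v ⬝ᵥ A.map Complex.ofReal *ᵥ v).re = 0 := by
    have h : star (star v ⬝ᵥ A.map Complex.ofReal *ᵥ v)
        = -(star v ⬝ᵥ A.map Complex.ofReal *ᵥ v) := by
      have hmap : (A.map Complex.ofReal)ᴴ = -A.map Complex.ofReal := by
        ext i k
        have := congrFun (congrFun hA i) k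
        simp only [transpose_apply, Matrix.neg_apply] at this
        simp [this]
      rw [← star_dotProduct, star_mulVec, hmap, ← dotProduct_mulVec, neg_mulVec,
        dotProduct_neg]
    have h' := congrArg Complex.re h
    simp only [Complex.star_def, Complex.conj_re, Complex.neg_re] at h'
    linarith
  have heq : star v ⬝ᵥ (μ • v) = star v ⬝ᵥ A.map Complex.ofReal *ᵥ v
      + star v ⬝ᵥ (diagonal d).map Complex.ofReal *ᵥ v := by
    rw [← dotProduct_add, ← add_mulVec]
    congr 1
    rw [sub_mulVec, sub_eq_zero, scalar_apply, ← smul_one_eq_diagonal, smul_mulVec,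
      one_mulVec] at hv0
    exact hv0
  have hnorm : star v ⬝ᵥ v = ((∑ i, Complex.normSq (v i) : ℝ) : ℂ) := by
    simp [dotProduct, Complex.normSq_eq_conj_mul_self]
  have hdiag : star v ⬝ᵥ (diagonal d).map Complex.ofReal *ᵥ v
      = ((∑ i, d i * Complex.normSq (v i) : ℝ) : ℂ) := by
    rw [diagonal_map (by simp)]
    simp only [dotProduct, mulVec_diagonal, Complex.ofReal_sum, Complex.ofReal_mul,
      Complex.normSq_eq_conj_mul_self, Pi.star_apply, Complex.star_def]
    exact Finset.sum_congr rfl fun i _ => by ring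
  rw [dotProduct_smul, hnorm, hdiag, smul_eq_mul] at heq
  have h := congrArg Complex.re heq
  rwa [Complex.re_mul_ofReal, Complex.add_re, hskew, zero_add, Complex.ofReal_re] at h

lemma re_pos_of_mem_roots_charpoly {n : Type*} [Fintype n] [DecidableEq n]
    {A : Matrix n n ℝ} (hA : Aᵀ = -A) {d : n → ℝ} (hd : ∀ i, 0 < d i) {μ : ℂ}
    (hμ : μ ∈ (A.map Complex.ofReal + (diagonal d).map Complex.ofReal).charpoly.roots) :
    0 < μ.re := by
  obtain ⟨w, hw, ⟨j, hj⟩, h⟩ := exists_re_mul_sum_eq_of_mem_roots_charpoly hA d hμ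
  refine pos_of_mul_pos_left (b := ∑ i, w i) ?_ (Finset.sum_nonneg fun i _ => hw i)
  rw [h]
  exact Finset.sum_pos' (fun i _ => mul_nonneg (hd i).le (hw i))
    ⟨j, Finset.mem_univ j, mul_pos (hd j) hj⟩

lemma re_neg_of_mem_roots_charpoly {n : Type*} [Fintype n] [DecidableEq n]
    {A : Matrix n n ℝ} (hA : Aᵀ = -A) {d : n → ℝ} (hd : ∀ i, 0 < d i) {μ : ℂ}
    (hμ : μ ∈ (A.map Complex.ofReal - (diagonal d).map Complex.ofReal).charpoly.roots) :
    μ.re < 0 := by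
  have hsub : A.map Complex.ofReal - (diagonal d).map Complex.ofReal
      = A.map Complex.ofReal + (diagonal (-d)).map Complex.ofReal := by
    rw [sub_eq_add_neg]
    congr 1
    ext i j
    by_cases h : i = j <;> simp [h]
  rw [hsub] at hμ
  obtain ⟨w, hw, ⟨j, hj⟩, h⟩ := exists_re_mul_sum_eq_of_mem_roots_charpoly hA (-d) hμ
  refine neg_pos.mp
    (pos_of_mul_pos_left (b := ∑ i, w i) ?_ (Finset.sum_nonneg fun i _ => hw i))
  rw [neg_mul, h, ← Finset.sum_neg_distrib]
  exact Finset.sum_pos' (fun i _ => by simpa using mul_nonneg (hd i).le (hw i))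
    ⟨j, Finset.mem_univ j, by simpa using mul_pos (hd j) hj⟩

/-- A block matrix of the form `[[A, iD], [-iD, A]]` is similar to `[[A + D, 0], [0, A - D]]`. -/
lemma charpoly_fromBlocks_I_smul {n : Type*} [Fintype n] [DecidableEq n] (A D : Matrix n n ℂ) :
    (fromBlocks A (Complex.I • D) (-Complex.I • D) A).charpoly
      = (A + D).charpoly * (A - D).charpoly := by
  let P : Matrix (n ⊕ n) (n ⊕ n) ℂ := fromBlocks 1 1 (-Complex.I • 1) (Complex.I • 1)
  let Q : Matrix (n ⊕ n) (n ⊕ n) ℂ := fromBlocks ((1 / 2 : ℂ) • 1) ((Complex.I / 2) • 1)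
    ((1 / 2 : ℂ) • 1) (-(Complex.I / 2) • 1)
  have hQP : Q * P = 1 := by
    simp only [P, Q, fromBlocks_multiply, ← fromBlocks_one]
    congr 1 <;>
      simp only [mul_smul_comm, mul_one, smul_smul, ← add_smul] <;>
      ring_nf <;> simp <;> norm_num
  have hMP : fromBlocks A (Complex.I • D) (-Complex.I • D) A * P
      = P * fromBlocks (A + D) 0 0 (A - D) := by
    simp only [P, fromBlocks_multiply]
    congr 1 <;>
      simp only [smul_mul_assoc, mul_smul_comm, one_mul, mul_one, mul_zero, smul_smul,
        zero_add, add_zero, smul_add, smul_sub, neg_mul, mul_neg, Complex.I_mul_I, neg_smul,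
        neg_neg, one_smul] <;> abel
  have hPQ : P * Q = 1 := mul_eq_one_comm.mp hQP
  calc (fromBlocks A (Complex.I • D) (-Complex.I • D) A).charpoly
      = (P * (fromBlocks (A + D) 0 0 (A - D) * Q)).charpoly := by
        rw [← mul_assoc, ← hMP, mul_assoc, hPQ, mul_one]
    _ = (fromBlocks (A + D) 0 0 (A - D)).charpoly := by
        rw [charpoly_mul_comm, mul_assoc, hQP, mul_one]
    _ = (A + D).charpoly * (A - D).charpoly := charpoly_fromBlocks_zero₁₂ ..

lemma card_roots_charpoly {n : Type*} [Fintype n] [DecidableEq n] (B : Matrix n n ℂ) :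
    B.charpoly.roots.card = Fintype.card n := by
  rw [← (IsAlgClosed.splits B.charpoly).natDegree_eq_card_roots, charpoly_natDegree_eq_dim]

/-- **Sum rule for the single-particle rapidities in a steady-state sector.**
For real antisymmetric `A` and strictly positive dissipation strengths `γ`, with
`D = diagonal (2γ)` and `M = [[A_ℂ, i·D_ℂ], [-i·D_ℂ, A_ℂ]]`, among the `2N`
roots of the characteristic polynomial of `M` (with multiplicity) exactly `N`
have positive real part and exactly `N` have negative real part, and the sum of
the roots with positive real part equals `2·Σ_j γ_j`. -/
theorem rapidity_sum_rule (N : ℕ) (hN : 1 ≤ N)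
    (A : Matrix (Fin N) (Fin N) ℝ) (hA : Aᵀ = -A)
    (γ : Fin N → ℝ) (hγ : ∀ j, 0 < γ j)
    (D : Matrix (Fin N) (Fin N) ℝ) (hD : D = Matrix.diagonal (fun j => 2 * γ j))
    (M : Matrix (Fin N ⊕ Fin N) (Fin N ⊕ Fin N) ℂ)
    (hM : M = Matrix.fromBlocks (A.map Complex.ofReal)
      (Complex.I • D.map Complex.ofReal)
      ((-Complex.I) • D.map Complex.ofReal) (A.map Complex.ofReal)) :
    (M.charpoly.roots.filter (fun z => 0 < z.re)).card = N ∧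
      (M.charpoly.roots.filter (fun z => z.re < 0)).card = N ∧
      (M.charpoly.roots.filter (fun z => 0 < z.re)).sum
        = ((2 * ∑ j, γ j : ℝ) : ℂ) := by
  subst hM hD
  have hd : ∀ j, 0 < 2 * γ j := fun j => mul_pos two_pos (hγ j)
  have hpos := fun μ => re_pos_of_mem_roots_charpoly (μ := μ) hA hd
  have hneg := fun μ => re_neg_of_mem_roots_charpoly (μ := μ) hA hd
  rw [charpoly_fromBlocks_I_smul, Polynomial.roots_mul
    (mul_ne_zero (charpoly_monic _).ne_zero (charpoly_monic _).ne_zero),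
    Multiset.filter_add, Multiset.filter_add,
    Multiset.filter_eq_self.mpr hpos, Multiset.filter_eq_self.mpr hneg,
    Multiset.filter_eq_nil.mpr fun μ h => (hneg μ h).not_gt,
    Multiset.filter_eq_nil.mpr fun μ h => (hpos μ h).not_gt,
    add_zero, zero_add]
  refine ⟨by simp [card_roots_charpoly], by simp [card_roots_charpoly], ?_⟩
  have hdiag : ∀ i, A i i = 0 := fun i => by
    have := congrFun (congrFun hA i) i
    simp only [transpose_apply, Matrix.neg_apply] at this
    linarith
  rw [← trace_eq_sum_roots_charpoly]
  simp [trace, hdiag, Finset.mul_sum]
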